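/- arXiv:1002.3281 — 4 statements merged into one kernel-verified Lean document; each statement's English description precedes it below -/
import Mathlib

section
/- The integral over the domain D₀ = {(A,B,a,b,x,y) ∈ ℝ⁶ : |b| ≤ |a| ≤ |A|, Ba − Ax > 0, and xb − ay > 0} of the function exp(−(A² + B²) − (Ba − Ax) − (xb − ay)) with respect to Lebesgue measure on ℝ⁶ is finite, and in fact equals 4π. -/
open MeasureTheory

/-- The exponential density on the positive half-line. -/
noncomputable def expDensity (t : ℝ) : ENNReal :=
  (Set.Ioi (0 : ℝ)).indicator (fun t => ENNReal.ofReal (Real.exp (-t))) t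

/-- The indicator function of the relation `|s| ≤ |t|`. -/
noncomputable def absLeIndicator (s t : ℝ) : ENNReal :=
  {p : ℝ × ℝ | |p.1| ≤ |p.2|}.indicator 1 (s, t)

/-- The Gaussian weight `exp (-t²)`. -/
noncomputable def gaussianWeight (t : ℝ) : ENNReal :=
  ENNReal.ofReal (Real.exp (-t ^ 2))

@[fun_prop]
lemma measurable_expDensity : Measurable expDensity := by
  unfold expDensity
  exact Measurable.indicator (by fun_prop) measurableSet_Ioi

lemma measurable_absLeIndicator : Measurable (fun p : ℝ × ℝ => absLeIndicator p.1 p.2) := by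
  unfold absLeIndicator
  exact measurable_one.indicator (measurableSet_le (by fun_prop) (by fun_prop))

@[fun_prop]
lemma Measurable.absLeIndicator {α : Type*} [MeasurableSpace α] {f g : α → ℝ}
    (hf : Measurable f) (hg : Measurable g) :
    Measurable (fun x => absLeIndicator (f x) (g x)) :=
  measurable_absLeIndicator.comp (hf.prodMk hg)

@[fun_prop]
lemma measurable_gaussianWeight : Measurable gaussianWeight := by
  unfold gaussianWeight
  fun_prop

lemma lintegral_expDensity : ∫⁻ t, expDensity t = 1 := by
  unfold expDensity
  rw [lintegral_indicator measurableSet_Ioi,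
    ← ofReal_integral_eq_lintegral_ofReal (integrableOn_exp_neg_Ioi 0)
      (Filter.Eventually.of_forall fun t => (Real.exp_pos _).le),
    integral_exp_neg_Ioi_zero, ENNReal.ofReal_one]

lemma lintegral_expDensity_affine {m : ℝ} (hm : m ≠ 0) (c : ℝ) :
    ∫⁻ t, expDensity (c - m * t) = ENNReal.ofReal |m⁻¹| := by
  have h := lintegral_map (μ := volume) (f := fun t => expDensity (c - t)) (g := fun t => m * t)
    (by fun_prop) (by fun_prop)
  rw [← h, Real.map_volume_mul_left hm, lintegral_smul_measure,
    lintegral_sub_left_eq_self expDensity c, lintegral_expDensity, smul_eq_mul, mul_one]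

lemma lintegral_absLeIndicator (t : ℝ) :
    ∫⁻ s, absLeIndicator s t = ENNReal.ofReal (2 * |t|) := by
  have h : (fun s => absLeIndicator s t) = (Set.Icc (-|t|) |t|).indicator 1 := by
    funext s
    simp [absLeIndicator, Set.indicator_apply, abs_le]
  rw [h, lintegral_indicator_one measurableSet_Icc, Real.volume_Icc]
  congr 1
  ring

lemma lintegral_gaussianWeight : ∫⁻ t, gaussianWeight t = ENNReal.ofReal √Real.pi := by
  unfold gaussianWeight
  rw [← ofReal_integral_eq_lintegral_ofReal
      (by simpa using integrable_exp_neg_mul_sq one_pos)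
      (Filter.Eventually.of_forall fun t => (Real.exp_pos _).le)]
  congr 1
  simpa using integral_gaussian 1

lemma ofReal_abs_inv_mul_ofReal_two_mul_abs {t : ℝ} (ht : t ≠ 0) :
    ENNReal.ofReal |t⁻¹| * ENNReal.ofReal (2 * |t|) = 2 := by
  rw [← ENNReal.ofReal_mul (abs_nonneg _), abs_inv,
    show |t|⁻¹ * (2 * |t|) = 2 by field_simp]
  simp

/-- The integrand, extended by zero outside the domain, splits into one-variable factors. -/
lemma indicator_energy_eq_mul (p : ℝ × ℝ × ℝ × ℝ × ℝ × ℝ) :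
    {p : ℝ × ℝ × ℝ × ℝ × ℝ × ℝ |
        |p.2.2.2.1| ≤ |p.2.2.1| ∧ |p.2.2.1| ≤ |p.1| ∧
        0 < p.2.1 * p.2.2.1 - p.1 * p.2.2.2.2.1 ∧
        0 < p.2.2.2.2.1 * p.2.2.2.1 - p.2.2.1 * p.2.2.2.2.2}.indicator
      (fun p => ENNReal.ofReal (Real.exp (-(p.1 ^ 2 + p.2.1 ^ 2)
        - (p.2.1 * p.2.2.1 - p.1 * p.2.2.2.2.1)
        - (p.2.2.2.2.1 * p.2.2.2.1 - p.2.2.1 * p.2.2.2.2.2)))) p =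
    gaussianWeight p.1 * (gaussianWeight p.2.1 * (absLeIndicator p.2.2.1 p.1 *
      (absLeIndicator p.2.2.2.1 p.2.2.1 *
        (expDensity (p.2.1 * p.2.2.1 - p.1 * p.2.2.2.2.1) *
          expDensity (p.2.2.2.2.1 * p.2.2.2.1 - p.2.2.1 * p.2.2.2.2.2))))) := by
  obtain ⟨A, B, a, b, x, y⟩ := p
  simp only [expDensity, absLeIndicator, gaussianWeight, Set.indicator_apply, Set.mem_ofPred_eq,
    Set.mem_Ioi, Pi.one_apply]
  by_cases h₁ : |b| ≤ |a| <;> by_cases h₂ : |a| ≤ |A| <;>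
    by_cases h₃ : 0 < B * a - A * x <;> by_cases h₄ : 0 < x * b - a * y <;>
    simp only [h₁, h₂, h₃, h₄, and_true, and_false, if_true, if_false, mul_zero, zero_mul,
      one_mul]
  rw [← ENNReal.ofReal_mul (Real.exp_pos _).le, ← ENNReal.ofReal_mul (Real.exp_pos _).le,
    ← ENNReal.ofReal_mul (Real.exp_pos _).le, ← Real.exp_add, ← Real.exp_add, ← Real.exp_add]
  congr 2
  ring

lemma lintegral_prod_real_eq {α : Type*} [MeasureSpace α] [SFinite (volume : Measure α)]
    {f : ℝ × α → ENNReal} (hf : Measurable f) :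
    ∫⁻ p, f p = ∫⁻ s, ∫⁻ q, f (s, q) := by
  rw [Measure.volume_eq_prod, lintegral_prod _ hf.aemeasurable]

lemma lintegral_expDensity_mul_expDensity {A a : ℝ} (hA : A ≠ 0) (ha : a ≠ 0) (B b : ℝ) :
    ∫⁻ q : ℝ × ℝ, expDensity (B * a - A * q.1) * expDensity (q.1 * b - a * q.2) =
      ENNReal.ofReal |A⁻¹| * ENNReal.ofReal |a⁻¹| := by
  rw [lintegral_prod_real_eq (by fun_prop)]
  have h (x : ℝ) : ∫⁻ y, expDensity (B * a - A * x) * expDensity (x * b - a * y) =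
      expDensity (B * a - A * x) * ENNReal.ofReal |a⁻¹| := by
    rw [lintegral_const_mul _ (by fun_prop), lintegral_expDensity_affine ha]
  simp_rw [h]
  rw [lintegral_mul_const _ (by fun_prop), lintegral_expDensity_affine hA]

lemma lintegral_absLeIndicator_mul_expDensity {A a : ℝ} (hA : A ≠ 0) (ha : a ≠ 0) (B : ℝ) :
    ∫⁻ q : ℝ × ℝ × ℝ, absLeIndicator q.1 a *
        (expDensity (B * a - A * q.2.1) * expDensity (q.2.1 * q.1 - a * q.2.2)) =
      2 * ENNReal.ofReal |A⁻¹| := by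
  rw [lintegral_prod_real_eq (by fun_prop)]
  have h (b : ℝ) : ∫⁻ q : ℝ × ℝ, absLeIndicator b a *
      (expDensity (B * a - A * q.1) * expDensity (q.1 * b - a * q.2)) =
      absLeIndicator b a * (ENNReal.ofReal |A⁻¹| * ENNReal.ofReal |a⁻¹|) := by
    rw [lintegral_const_mul _ (by fun_prop), lintegral_expDensity_mul_expDensity hA ha]
  simp_rw [h]
  rw [lintegral_mul_const _ (by fun_prop), lintegral_absLeIndicator,
    ← ofReal_abs_inv_mul_ofReal_two_mul_abs ha]
  ring

lemma lintegral_absLeIndicator_mul_absLeIndicator_mul_expDensity {A : ℝ} (hA : A ≠ 0) (B : ℝ) :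
    ∫⁻ q : ℝ × ℝ × ℝ × ℝ, absLeIndicator q.1 A * (absLeIndicator q.2.1 q.1 *
        (expDensity (B * q.1 - A * q.2.2.1) *
          expDensity (q.2.2.1 * q.2.1 - q.1 * q.2.2.2))) = 4 := by
  rw [lintegral_prod_real_eq (by fun_prop)]
  have h : ∀ᵐ a : ℝ, ∫⁻ q : ℝ × ℝ × ℝ, absLeIndicator a A * (absLeIndicator q.1 a *
      (expDensity (B * a - A * q.2.1) * expDensity (q.2.1 * q.1 - a * q.2.2))) =
      absLeIndicator a A * (2 * ENNReal.ofReal |A⁻¹|) := by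
    filter_upwards [Measure.ae_ne volume 0] with a ha
    rw [lintegral_const_mul _ (by fun_prop), lintegral_absLeIndicator_mul_expDensity hA ha]
  rw [lintegral_congr_ae h, lintegral_mul_const _ (by fun_prop), lintegral_absLeIndicator,
    show ENNReal.ofReal (2 * |A|) * (2 * ENNReal.ofReal |A⁻¹|) =
      2 * (ENNReal.ofReal |A⁻¹| * ENNReal.ofReal (2 * |A|)) by ring,
    ofReal_abs_inv_mul_ofReal_two_mul_abs hA]
  norm_num

/-- The integral over the domain
`D₀ = {(A,B,a,b,x,y) ∈ ℝ⁶ : |b| ≤ |a| ≤ |A|, Ba − Ax > 0, xb − ay > 0}`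
of `exp(−(A² + B²) − (Ba − Ax) − (xb − ay))` with respect to Lebesgue measure
is finite, and equals `4π`. -/
theorem torus_energy_integral_eq_four_pi :
    ∫⁻ p in {p : ℝ × ℝ × ℝ × ℝ × ℝ × ℝ |
        |p.2.2.2.1| ≤ |p.2.2.1| ∧ |p.2.2.1| ≤ |p.1| ∧
        0 < p.2.1 * p.2.2.1 - p.1 * p.2.2.2.2.1 ∧
        0 < p.2.2.2.2.1 * p.2.2.2.1 - p.2.2.1 * p.2.2.2.2.2},
      ENNReal.ofReal (Real.exp (-(p.1 ^ 2 + p.2.1 ^ 2)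
        - (p.2.1 * p.2.2.1 - p.1 * p.2.2.2.2.1)
        - (p.2.2.2.2.1 * p.2.2.2.1 - p.2.2.1 * p.2.2.2.2.2)))
      = ENNReal.ofReal (4 * Real.pi) := by
  rw [← lintegral_indicator, lintegral_congr indicator_energy_eq_mul,
    lintegral_prod_real_eq (by fun_prop)]
  swap
  · simp only [Set.ofPred_and]
    refine (measurableSet_le (α := ℝ) ?_ ?_).inter ((measurableSet_le (α := ℝ) ?_ ?_).inter
      ((measurableSet_lt (α := ℝ) ?_ ?_).inter (measurableSet_lt (α := ℝ) ?_ ?_))) <;> fun_prop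
  have h : ∀ᵐ A : ℝ, ∫⁻ q : ℝ × ℝ × ℝ × ℝ × ℝ, gaussianWeight A * (gaussianWeight q.1 *
      (absLeIndicator q.2.1 A * (absLeIndicator q.2.2.1 q.2.1 *
        (expDensity (q.1 * q.2.1 - A * q.2.2.2.1) *
          expDensity (q.2.2.2.1 * q.2.2.1 - q.2.1 * q.2.2.2.2))))) =
      gaussianWeight A * (ENNReal.ofReal √Real.pi * 4) := by
    filter_upwards [Measure.ae_ne volume 0] with A hA
    rw [lintegral_const_mul _ (by fun_prop), lintegral_prod_real_eq (by fun_prop)]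
    have hB (B : ℝ) : ∫⁻ q : ℝ × ℝ × ℝ × ℝ, gaussianWeight B * (absLeIndicator q.1 A *
        (absLeIndicator q.2.1 q.1 * (expDensity (B * q.1 - A * q.2.2.1) *
          expDensity (q.2.2.1 * q.2.1 - q.1 * q.2.2.2)))) = gaussianWeight B * 4 := by
      rw [lintegral_const_mul _ (by fun_prop),
        lintegral_absLeIndicator_mul_absLeIndicator_mul_expDensity hA]
    simp_rw [hB]
    rw [lintegral_mul_const _ (by fun_prop), lintegral_gaussianWeight]
  rw [lintegral_congr_ae h, lintegral_mul_const _ (by fun_prop), lintegral_gaussianWeight,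
    ← mul_assoc, ← ENNReal.ofReal_mul (Real.sqrt_nonneg _),
    Real.mul_self_sqrt Real.pi_pos.le, mul_comm, ENNReal.ofReal_mul (by norm_num)]
  norm_num
end

section
/- Let A be an m × n matrix over ℂ. Suppose that (i) there exists a column of A with exactly one nonzero entry, and (ii) the graph on the row indices {1,…,m}, in which two distinct rows i and i' are adjacent whenever there exists a column of A whose set of rows carrying nonzero entries is exactly {i, i'}, is connected. Then the m rows of A are linearly independent; equivalently, A has rank m. -/
open scoped Matrix

/-- If `A b j ≠ 0` and a left null vector of `A` vanishes at every other row in the support of the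
column `j`, then it vanishes at `b`. -/
theorem Matrix.eq_zero_of_vecMul_eq_zero_of_column
    {R ι κ : Type*} [Semiring R] [NoZeroDivisors R] [Fintype ι]
    {A : Matrix ι κ R} {g : ι → R} (hg : g ᵥ* A = 0) {b : ι} {j : κ}
    (hb : A b j ≠ 0) (h : ∀ i ≠ b, A i j ≠ 0 → g i = 0) : g b = 0 := by
  have hsum : ∑ i, g i * A i j = 0 := congrFun hg j
  rw [Fintype.sum_eq_single b] at hsum
  · exact (mul_eq_zero.mp hsum).resolve_right hb
  · intro i hib
    by_cases hij : A i j = 0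
    · rw [hij, mul_zero]
    · rw [h i hib hij, zero_mul]

/-- Let `A` be an `m × n` complex matrix.  Suppose (i) some column of `A` has
exactly one nonzero entry, and (ii) the graph on row indices in which two
distinct rows `i`, `i'` are adjacent whenever some column of `A` has its set of
nonzero entries exactly in rows `{i, i'}` is connected.  Then the rows of `A`
are linearly independent; equivalently, `A` has rank `m`. -/
theorem rows_linearIndependent_of_boundary_column_and_connected
    (m n : ℕ) (A : Matrix (Fin m) (Fin n) ℂ)
    (h1 : ∃ j : Fin n, ∃! i : Fin m, A i j ≠ 0)
    (h2 : (SimpleGraph.fromRel (fun i i' : Fin m =>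
        ∃ j : Fin n, ∀ i'' : Fin m, A i'' j ≠ 0 ↔ (i'' = i ∨ i'' = i'))).Connected) :
    LinearIndependent ℂ (fun i : Fin m => A i) ∧ A.rank = m := by
  have hrows : LinearIndependent ℂ A.row := by
    rw [← Matrix.vecMul_injective_iff, ← Matrix.coe_vecMulLinear, injective_iff_map_eq_zero]
    intro g hg
    replace hg : g ᵥ* A = 0 := hg
    obtain ⟨j, i₀, hi₀, huniq⟩ := h1
    have hbase : g i₀ = 0 :=
      Matrix.eq_zero_of_vecMul_eq_zero_of_column hg hi₀ fun i hi hij => absurd (huniq i hij) hi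
    funext i
    obtain ⟨walk⟩ := h2.preconnected i i₀
    induction walk with
    | nil => exact hbase
    | cons hadj _ ih =>
      have hnext := ih hi₀ huniq hbase
      obtain ⟨-, ⟨k, hk⟩ | ⟨k, hk⟩⟩ := (SimpleGraph.fromRel_adj _ _ _).mp hadj
      · refine Matrix.eq_zero_of_vecMul_eq_zero_of_column hg ((hk _).mpr (.inl rfl)) ?_
        intro i hi hik
        rwa [((hk i).mp hik).resolve_left hi]
      · refine Matrix.eq_zero_of_vecMul_eq_zero_of_column hg ((hk _).mpr (.inr rfl)) ?_
        intro i hi hik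
        rwa [((hk i).mp hik).resolve_right hi]
  exact ⟨hrows, by simpa using hrows.rank_matrix⟩
end

section
/- Let A be an m × n matrix over ℂ in which every column has exactly one or exactly two nonzero entries. Let I_b ⊆ {1,…,n} be the set of columns with exactly one nonzero entry; assume I_b is nonempty and fix j₀ ∈ I_b. Suppose the graph on the row indices {1,…,m}, in which two distinct rows i and i' are adjacent whenever there exists a column of A whose set of rows carrying nonzero entries is exactly {i, i'}, is connected. Then the coordinate functionals z ↦ z_j for j ∈ I_b \ {j₀} are linearly independent as linear functionals on ker A (where A is viewed as a linear map ℂ^n → ℂ^m): if scalars (μ_j)_{j ∈ I_b \ {j₀}} satisfy Σ_{j ∈ I_b \ {j₀}} μ_j z_j = 0 for every z = (z_1,…,z_n) ∈ ker A, then every μ_j = 0. -/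
open Finset

section

variable {ι κ K : Type*} [DecidableEq ι] [Fintype κ] [DecidableEq κ] [Field K]

/-- A column supported on a single row `i` is a multiple of the basis vector at `i`. -/
lemma mulVec_single_one_of_support_singleton {A : Matrix ι κ K} {j : κ} {i : ι}
    (h : ∀ k, A k j ≠ 0 ↔ k = i) :
    A.mulVec (Pi.single j 1) = A i j • Pi.single i 1 := by
  ext k
  by_cases hk : k = i
  · subst hk; simp
  · have : A k j = 0 := by simpa using mt (h k).1 hk
    simp [hk, this]

/-- A column supported on two distinct rows is a combination of their basis vectors. -/
lemma mulVec_single_one_of_support_pair {A : Matrix ι κ K} {j : κ} {i i' : ι} (hne : i ≠ i')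
    (h : ∀ k, A k j ≠ 0 ↔ (k = i ∨ k = i')) :
    A.mulVec (Pi.single j 1) = A i j • Pi.single i 1 + A i' j • Pi.single i' 1 := by
  ext k
  by_cases hk : k = i
  · subst hk; simp [hne]
  · by_cases hk' : k = i'
    · subst hk'; simp [hk]
    · have : A k j = 0 := by simpa using mt (h k).1 (by tauto)
      simp [hk, hk', this]

/-- If the rows `i` and `k` are joined by a path of columns with exactly two nonzero entries, and
no such column lies in `S`, then the basis vector at `i` is congruent to a multiple of that at `k`
modulo the image under `A` of the vectors vanishing on `S`. -/
lemma exists_mulVec_eq_single_sub_of_reachable {A : Matrix ι κ K} {S : Set κ}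
    (hS : ∀ j i i', i ≠ i' → (∀ k, A k j ≠ 0 ↔ (k = i ∨ k = i')) → j ∉ S) {i k : ι}
    (h : (SimpleGraph.fromRel (fun i i' : ι =>
        ∃ j : κ, ∀ i'' : ι, A i'' j ≠ 0 ↔ (i'' = i ∨ i'' = i'))).Reachable i k) :
    ∃ (z : κ → K) (d : K), (∀ j ∈ S, z j = 0) ∧
      A.mulVec z = Pi.single i 1 - d • Pi.single k 1 := by
  obtain ⟨w⟩ := h
  induction w with
  | nil => exact ⟨0, 1, by simp, by simp⟩
  | @cons a b c hab _ ih =>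
    obtain ⟨z, d, hz, hAz⟩ := ih
    rw [SimpleGraph.fromRel_adj] at hab
    obtain ⟨hne, hab⟩ := hab
    obtain ⟨j, hj⟩ : ∃ j : κ, ∀ k, A k j ≠ 0 ↔ (k = a ∨ k = b) := by
      rcases hab with h | ⟨j, hj⟩
      · exact h
      · exact ⟨j, fun k => (hj k).trans or_comm⟩
    have hjS := hS j a b hne hj
    have ha : A a j ≠ 0 := (hj a).2 (Or.inl rfl)
    refine ⟨(A a j)⁻¹ • Pi.single j 1 - ((A a j)⁻¹ * A b j) • z, -((A a j)⁻¹ * A b j * d),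
      fun l hl => ?_, ?_⟩
    · have : l ≠ j := fun h => hjS (h ▸ hl)
      simp [hz l hl, this]
    · rw [Matrix.mulVec_sub, Matrix.mulVec_smul, Matrix.mulVec_smul, hAz,
        mulVec_single_one_of_support_pair hne hj, smul_add, smul_smul, inv_mul_cancel₀ ha]
      module

end

/-- Let `A` be an `m × n` complex matrix in which every column has exactly one
or exactly two nonzero entries; let `Ib` be the (nonempty) set of columns with
exactly one nonzero entry and fix `j₀ ∈ Ib`.  If the adjacency graph on the rows
(two distinct rows adjacent whenever some column has its nonzero entries exactly
in those two rows) is connected, then the coordinate functionals `z ↦ z_j`,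
`j ∈ Ib \ {j₀}`, are linearly independent on `ker A`: any relation
`Σ_{j ∈ Ib \ {j₀}} μ_j z_j = 0` valid on `ker A` has all `μ_j = 0`. -/
theorem coords_linearIndependent_on_ker
    (m n : ℕ) (A : Matrix (Fin m) (Fin n) ℂ)
    (hcol : ∀ j : Fin n, {i : Fin m | A i j ≠ 0}.ncard = 1 ∨ {i : Fin m | A i j ≠ 0}.ncard = 2)
    (Ib : Finset (Fin n)) (hIb : ∀ j : Fin n, j ∈ Ib ↔ {i : Fin m | A i j ≠ 0}.ncard = 1)
    (j₀ : Fin n) (hj₀ : j₀ ∈ Ib)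
    (hconn : (SimpleGraph.fromRel (fun i i' : Fin m =>
        ∃ j : Fin n, ∀ i'' : Fin m, A i'' j ≠ 0 ↔ (i'' = i ∨ i'' = i'))).Connected)
    (μ : Fin n → ℂ)
    (hrel : ∀ z : Fin n → ℂ, A.mulVec z = 0 → ∑ j ∈ Ib.erase j₀, μ j * z j = 0) :
    ∀ j ∈ Ib.erase j₀, μ j = 0 := by
  intro j hj
  have hsupp : ∀ l ∈ Ib, ∃ i, ∀ k, A k l ≠ 0 ↔ k = i := fun l hl => by
    obtain ⟨i, hi⟩ := Set.ncard_eq_one.1 ((hIb l).1 hl)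
    exact ⟨i, fun k => by simpa using Set.ext_iff.1 hi k⟩
  obtain ⟨hne, hjb⟩ := Finset.mem_erase.1 hj
  obtain ⟨i, hi⟩ := hsupp j hjb
  obtain ⟨i₀, hi₀⟩ := hsupp j₀ hj₀
  obtain ⟨z, d, hz, hAz⟩ := exists_mulVec_eq_single_sub_of_reachable (A := A) (S := ↑Ib)
    (fun l a b hab hl hlS => by
      obtain ⟨c, hc⟩ := hsupp l hlS
      exact hab (((hc a).1 ((hl a).2 (Or.inl rfl))).trans
        ((hc b).1 ((hl b).2 (Or.inr rfl))).symm))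
    (hconn.preconnected i i₀)
  have h₀ : A i₀ j₀ ≠ 0 := (hi₀ i₀).2 rfl
  have key := hrel (Pi.single j 1 - A i j • z - (A i j * d * (A i₀ j₀)⁻¹) • Pi.single j₀ 1) (by
    rw [Matrix.mulVec_sub, Matrix.mulVec_sub, Matrix.mulVec_smul, Matrix.mulVec_smul, hAz,
      mulVec_single_one_of_support_singleton hi, mulVec_single_one_of_support_singleton hi₀,
      smul_smul, inv_mul_cancel_right₀ h₀]
    module)
  rw [Finset.sum_eq_single_of_mem j hj] at key
  · simpa [hz j hjb, hne] using key
  · intro l hl hlj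
    obtain ⟨hl₀, hlb⟩ := Finset.mem_erase.1 hl
    simp [hz l hlb, hl₀, hlj]
end

section
/- Let Λ ⊂ ℝ² be a lattice (a discrete additive subgroup of ℝ² spanning ℝ² over ℝ). Let p, q ∈ ℝ² with q − p ∉ Λ, and suppose the segment S = {(1−s)p + sq : s ∈ [0,1]} embeds in the flat torus ℝ²/Λ, i.e., for all s, s' ∈ [0,1], ((1−s)p + sq) − ((1−s')p + s'q) ∈ Λ implies s = s'. Then there exists v ∈ Λ with v ≠ 0 such that: (a) for all t ∈ ℝ and all s ∈ [0,1], if p + t·v − ((1−s)p + sq) ∈ Λ then s = 0; and (b) for all t ∈ ℝ and all s ∈ [0,1], if q + t·v − ((1−s)p + sq) ∈ Λ then s = 1. -/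
open Module in
/-- A lattice in the plane consists of the vectors with integer coordinates in some real basis. -/
lemma exists_basis_forall_mem_iff_repr_int (Λ : AddSubgroup (ℝ × ℝ)) [DiscreteTopology Λ]
    (hspan : Submodule.span ℝ (Λ : Set (ℝ × ℝ)) = ⊤) :
    ∃ B : Basis (Fin 2) ℝ (ℝ × ℝ), ∀ x, x ∈ Λ ↔ ∀ i, ∃ k : ℤ, (k : ℝ) = B.repr x i := by
  let L : Submodule ℤ (ℝ × ℝ) := AddSubgroup.toIntSubmodule Λ
  have : DiscreteTopology L := ‹DiscreteTopology Λ›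
  have : IsZLattice ℝ L := ⟨hspan⟩
  have : Module.Free ℤ L := ZLattice.module_free ℝ L
  have : Module.Finite ℤ L := ZLattice.module_finite ℝ L
  have hrank : finrank ℤ L = 2 := by
    rw [ZLattice.rank ℝ L]
    simp
  let b : Basis (Fin 2) ℤ L := finBasisOfFinrankEq ℤ L hrank
  refine ⟨b.ofZLatticeBasis ℝ L, fun x => ?_⟩
  have hx : x ∈ Λ ↔ x ∈ Submodule.span ℤ (Set.range (b.ofZLatticeBasis ℝ L)) := by
    rw [b.ofZLatticeBasis_span ℝ L]
    rfl
  rw [hx, Basis.mem_span_iff_repr_mem]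
  simp

/-- If no nonzero multiple `s • (a, b)` with `|s| ≤ 1` is an integer vector, then some integer
linear form takes at `(a, b)` a nonzero value of absolute value less than one. -/
lemma exists_int_combination_abs_lt_one {a b : ℝ}
    (h : ∀ s : ℝ, |s| ≤ 1 → (∃ k : ℤ, (k : ℝ) = s * a) → (∃ k : ℤ, (k : ℝ) = s * b) → s = 0) :
    ∃ m n : ℤ, m * a + n * b ≠ 0 ∧ |m * a + n * b| < 1 := by
  let G : AddSubgroup ℝ := AddSubgroup.closure {a, b}
  have hG : ∀ x ∈ G, ∃ m n : ℤ, m * a + n * b = x := fun x hx => by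
    simpa using AddSubgroup.mem_closure_pair.mp hx
  have ha : a ∈ G := AddSubgroup.subset_closure (by simp)
  have hb : b ∈ G := AddSubgroup.subset_closure (by simp)
  suffices ∃ x ∈ G, x ≠ 0 ∧ |x| < 1 by
    obtain ⟨x, hx, hx0, hx1⟩ := this
    obtain ⟨m, n, rfl⟩ := hG x hx
    exact ⟨m, n, hx0, hx1⟩
  rcases G.dense_or_cyclic with hd | ⟨c, hc⟩
  · obtain ⟨x, hxG, hx0, hx1⟩ := hd.exists_between (zero_lt_one (α := ℝ))
    exact ⟨x, hxG, hx0.ne', by rwa [abs_of_pos hx0]⟩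
  · have hcG : c ∈ G := hc ▸ AddSubgroup.subset_closure rfl
    rw [hc, AddSubgroup.mem_closure_singleton] at ha hb
    obtain ⟨k, rfl⟩ := ha
    obtain ⟨l, rfl⟩ := hb
    have hc0 : c ≠ 0 := by
      rintro rfl
      exact one_ne_zero (h 1 (by simp) ⟨0, by simp⟩ ⟨0, by simp⟩)
    refine ⟨c, hcG, hc0, ?_⟩
    by_contra! hc1
    refine inv_ne_zero hc0 (h c⁻¹ ?_ ⟨k, ?_⟩ ⟨l, ?_⟩)
    · rw [abs_inv]
      exact inv_le_one_of_one_le₀ hc1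
    · rw [zsmul_eq_mul]
      field_simp
    · rw [zsmul_eq_mul]
      field_simp

/-- If no nonzero multiple `s • w` with `|s| ≤ 1` lies in the lattice `Λ`, then for some nonzero
`v ∈ Λ` the closed geodesics in direction `v` meet `[0, 1] • w` in the torus at most once. -/
lemma exists_mem_lattice_forall_smul_add_smul_mem (Λ : AddSubgroup (ℝ × ℝ)) [DiscreteTopology Λ]
    (hspan : Submodule.span ℝ (Λ : Set (ℝ × ℝ)) = ⊤) {w : ℝ × ℝ}
    (hw : ∀ s : ℝ, |s| ≤ 1 → s • w ∈ Λ → s = 0) :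
    ∃ v ∈ Λ, v ≠ 0 ∧ ∀ t s : ℝ, |s| ≤ 1 → t • v + s • w ∈ Λ → s = 0 := by
  obtain ⟨B, hB⟩ := exists_basis_forall_mem_iff_repr_int Λ hspan
  obtain ⟨m, n, hne, hlt⟩ :=
    exists_int_combination_abs_lt_one (a := B.repr w 0) (b := B.repr w 1) fun s hs h0 h1 =>
      hw s hs ((hB _).mpr (by simpa [Fin.forall_fin_two] using ⟨h0, h1⟩))
  let v : ℝ × ℝ := (-n : ℝ) • B 0 + (m : ℝ) • B 1
  have hv0 : B.repr v 0 = -n := by simp [v]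
  have hv1 : B.repr v 1 = m := by simp [v]
  refine ⟨v, (hB v).mpr ?_, ?_, fun t s hs hmem => ?_⟩
  · rw [Fin.forall_fin_two, hv0, hv1]
    exact ⟨⟨-n, by simp⟩, ⟨m, rfl⟩⟩
  · intro hv
    have hn : (n : ℝ) = 0 := by simpa [hv] using hv0
    have hm : (m : ℝ) = 0 := by simpa [hv] using hv1.symm
    exact hne (by simp [hn, hm])
  · obtain ⟨⟨k, hk⟩, ⟨l, hl⟩⟩ := Fin.forall_fin_two.mp ((hB _).mp hmem)
    simp only [map_add, map_smul, Finsupp.add_apply, Finsupp.smul_apply, smul_eq_mul,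
      hv0, hv1] at hk hl
    have hform : ((m * k + n * l : ℤ) : ℝ) = s * (m * B.repr w 0 + n * B.repr w 1) := by
      push_cast
      rw [hk, hl]
      ring
    have habs : |((m * k + n * l : ℤ) : ℝ)| < 1 := by
      rw [hform, abs_mul]
      exact (mul_le_of_le_one_left (abs_nonneg _) hs).trans_lt hlt
    have hzero : m * k + n * l = 0 := Int.abs_lt_one_iff.mp (by exact_mod_cast habs)
    rw [hzero, Int.cast_zero] at hform
    exact (mul_eq_zero.mp hform.symm).resolve_right hne

/-- Let `Λ ⊂ ℝ²` be a lattice (discrete subgroup spanning `ℝ²`), and `p, q ∈ ℝ²`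
with `q − p ∉ Λ` such that the segment `S` from `p` to `q` embeds in the torus
`ℝ²/Λ`.  Then there is a nonzero `v ∈ Λ` such that the closed geodesic through
(the image of) `p` in direction `v` meets (the image of) `S` only at `p`, and
the parallel closed geodesic through `q` meets `S` only at `q`. -/
theorem exists_parallel_closed_geodesics_through_endpoints
    (Λ : AddSubgroup (ℝ × ℝ)) (hdisc : DiscreteTopology Λ)
    (hspan : Submodule.span ℝ (Λ : Set (ℝ × ℝ)) = ⊤)
    (p q : ℝ × ℝ) (hpq : q - p ∉ Λ)
    (hemb : ∀ s ∈ Set.Icc (0 : ℝ) 1, ∀ s' ∈ Set.Icc (0 : ℝ) 1,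
      ((1 - s) • p + s • q) - ((1 - s') • p + s' • q) ∈ Λ → s = s') :
    ∃ v ∈ Λ, v ≠ 0 ∧
      (∀ t : ℝ, ∀ s ∈ Set.Icc (0 : ℝ) 1,
        p + t • v - ((1 - s) • p + s • q) ∈ Λ → s = 0) ∧
      (∀ t : ℝ, ∀ s ∈ Set.Icc (0 : ℝ) 1,
        q + t • v - ((1 - s) • p + s • q) ∈ Λ → s = 1) := by
  have hw : ∀ s : ℝ, |s| ≤ 1 → s • (q - p) ∈ Λ → s = 0 := fun s hs hmem => by
    rcases le_total 0 s with h0 | h0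
    · refine hemb s ⟨h0, (le_abs_self s).trans hs⟩ 0 (by simp) ?_
      convert hmem using 1
      module
    · refine neg_eq_zero.mp
        (hemb 0 (by simp) (-s) ⟨neg_nonneg.mpr h0, (neg_le_abs s).trans hs⟩ ?_).symm
      convert hmem using 1
      module
  obtain ⟨v, hv, hv0, hmeet⟩ := exists_mem_lattice_forall_smul_add_smul_mem Λ hspan hw
  refine ⟨v, hv, hv0, fun t s hs hmem => ?_, fun t s hs hmem => ?_⟩
  · refine neg_eq_zero.mp (hmeet t (-s) ?_ ?_)
    · rw [abs_neg, abs_of_nonneg hs.1]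
      exact hs.2
    · convert hmem using 1
      module
  · refine (sub_eq_zero.mp (hmeet t (1 - s) ?_ ?_)).symm
    · rw [abs_of_nonneg (sub_nonneg.mpr hs.2)]
      linarith [hs.1]
    · convert hmem using 1
      module
end
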